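/- arXiv:2508.10087 — 2 statements merged into one kernel-verified Lean document; each statement's English description precedes it below -/
import Mathlib

section
/- Let s, t ≥ 2 be coprime integers, r ≥ 1 an integer, and σ ∈ {+1,−1}. Set j₀ = (st−s−t−1)/2 and Δ_r = (r + 1/r)/4 + σ·j₀(j₀+1)/(st) + σ·(t²−1)(s²−1)/(4st) − r(j₀ + 1/2 + 1/(2r))² + ((2r+1)(j₀+1)² − (j₀+1))/2. For n ∈ ℕ define the integer b_n = Σ ε(j)·(−1)^k·sᵢ, where the sum runs over all (i,j,k) with i ∈ {1,2,3,4}, j,k ∈ ℕ, k ≥ j+1, ε(j) ≠ 0 and ψᵢ(j,k) = Δ_r + n, with s₁ = s₂ = +1, s₃ = s₄ = −1. Let p_r(n) denote the number of partitions of n into parts congruent to 0, r, or r+1 modulo 2r+1, and set c_n = Σ_{m=0}^{n} p_r(n−m)·b_m. Then limsup_{n→∞} (log|c_n|)²/n ≤ 2π²/(2r+1); that is, the effective central charge of the coefficient sequence of the regularized +1/r-surgery series Ẑ(Σ̄(s,t,rst±1); q) is at most 3/(2r+1). -/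
open Filter

/-- `ε(j) ∈ {−1,0,1}`: it is `−1` if `2j+1 ≡ st ± (s+t) (mod 2st)`, `+1` if
`2j+1 ≡ st ± (s−t) (mod 2st)`, and `0` otherwise. -/
def eps (s t : ℤ) (j : ℕ) : ℤ :=
  if (2 * (j : ℤ) + 1) ≡ s * t + (s + t) [ZMOD 2 * s * t] ∨
      (2 * (j : ℤ) + 1) ≡ s * t - (s + t) [ZMOD 2 * s * t] then -1
  else if (2 * (j : ℤ) + 1) ≡ s * t + (s - t) [ZMOD 2 * s * t] ∨
      (2 * (j : ℤ) + 1) ≡ s * t - (s - t) [ZMOD 2 * s * t] then 1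
  else 0

/-- `ψ₁(j,k) = (r + 1/r)/4 + σ·j(j+1)/(st) + σ·(t²−1)(s²−1)/(4st)
− r(j + 1/2 − 1/(2r))² + ((2r+1)k² + k)/2`. -/
def psi1 (s t σ : ℤ) (r : ℕ) (j k : ℕ) : ℚ :=
  ((r : ℚ) + 1 / (r : ℚ)) / 4 + (σ : ℚ) * ((j : ℚ) * ((j : ℚ) + 1)) / ((s : ℚ) * (t : ℚ))
    + (σ : ℚ) * (((t : ℚ) ^ 2 - 1) * ((s : ℚ) ^ 2 - 1)) / (4 * (s : ℚ) * (t : ℚ))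
    - (r : ℚ) * ((j : ℚ) + 1 / 2 - 1 / (2 * (r : ℚ))) ^ 2
    + ((2 * (r : ℚ) + 1) * (k : ℚ) ^ 2 + (k : ℚ)) / 2

/-- `ψᵢ` for `i ∈ {1,2,3,4}`:
`ψ₂ = ψ₁ − k`, `ψ₃ = ψ₁ − (2j+1)`, `ψ₄ = ψ₁ − k − (2j+1)`. -/
def psi (s t σ : ℤ) (r : ℕ) (i j k : ℕ) : ℚ :=
  match i with
  | 1 => psi1 s t σ r j k
  | 2 => psi1 s t σ r j k - (k : ℚ)
  | 3 => psi1 s t σ r j k - (2 * (j : ℚ) + 1)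
  | 4 => psi1 s t σ r j k - (k : ℚ) - (2 * (j : ℚ) + 1)
  | _ => 0

/-- `p_r(n)`: the number of partitions of `n` into parts congruent to `0`, `r` or `r+1`
modulo `2r+1`. -/
noncomputable def pr (r n : ℕ) : ℕ :=
  Nat.card {P : Nat.Partition n //
    ∀ x ∈ P.parts, x % (2 * r + 1) = 0 ∨ x % (2 * r + 1) = r ∨ x % (2 * r + 1) = r + 1}

def allowed (r N : ℕ) : Finset ℕ := (Finset.Icc 1 N).filter
  (fun x => x % (2 * r + 1) = 0 ∨ x % (2 * r + 1) = r ∨ x % (2 * r + 1) = r + 1)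

lemma geom_sum_le_inv (y : ℝ) (h0 : 0 ≤ y) (h1 : y < 1) (N : ℕ) :
    ∑ c ∈ Finset.range N, y ^ c ≤ (1 - y)⁻¹ := by
  rw [← tsum_geometric_of_lt_one h0 h1]
  exact (summable_geometric_of_lt_one h0 h1).sum_le_tsum _ (fun i _ => by positivity)

lemma pr_bound (r n N : ℕ) (hn : n ≤ N) (x : ℝ) (hx : 0 < x) :
    (pr r n : ℝ) ≤ Real.exp (x * n) *
      ∏ k ∈ allowed r N, (1 - Real.exp (-x * k))⁻¹ := by
  classical
  set S := allowed r N with hS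
  have hpos : ∀ k ∈ S, 1 ≤ k := by
    intro k hk
    rw [hS, allowed, Finset.mem_filter, Finset.mem_Icc] at hk
    exact hk.1.1
  let T := {P : Nat.Partition n //
    ∀ x ∈ P.parts, x % (2 * r + 1) = 0 ∨ x % (2 * r + 1) = r ∨ x % (2 * r + 1) = r + 1}
  let φ : T → (S → ℕ) := fun P i => P.1.parts.count i.1
  have hsub : ∀ P : T, P.1.parts.toFinset ⊆ S := by
    intro P k hk
    rw [Multiset.mem_toFinset] at hk
    rw [hS, allowed, Finset.mem_filter, Finset.mem_Icc]
    refine ⟨⟨P.1.parts_pos hk, ?_⟩, P.2 k hk⟩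
    exact (Multiset.le_sum_of_mem hk).trans (by rw [P.1.parts_sum]; exact hn)
  have hsum : ∀ P : T, ∑ k ∈ S, P.1.parts.count k * k = n := by
    intro P
    have := Finset.sum_multiset_count_of_subset P.1.parts S (hsub P)
    rw [P.1.parts_sum] at this
    simpa using this.symm
  have hinj : Function.Injective φ := by
    intro P Q h
    apply Subtype.ext
    apply Nat.Partition.ext
    ext k
    by_cases hk : k ∈ S
    · exact congrFun h ⟨k, hk⟩
    · rw [Multiset.count_eq_zero_of_notMem, Multiset.count_eq_zero_of_notMem]
      · exact fun h' => hk (hsub Q (by simpa using h'))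
      · exact fun h' => hk (hsub P (by simpa using h'))
  have hw : ∀ P : T, ∏ i : S, (Real.exp (-x * (i : ℕ))) ^ (φ P i) = Real.exp (-x * n) := by
    intro P
    rw [Finset.prod_coe_sort S (fun i => (Real.exp (-x * (i : ℕ))) ^ (P.1.parts.count i))]
    simp_rw [← Real.exp_nat_mul]
    rw [← Real.exp_sum]
    congr 1
    have hn' : (n : ℝ) = ∑ k ∈ S, (P.1.parts.count k : ℝ) * (k : ℝ) := by
      exact_mod_cast (hsum P).symm
    rw [hn', Finset.mul_sum]
    exact Finset.sum_congr rfl fun i _ => by ring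
  have hle : ∀ (P : T) (i : S), φ P i < n + 1 := by
    intro P i
    have h1 := Finset.single_le_sum (f := fun k => P.1.parts.count k * k) (fun _ _ => Nat.zero_le _) i.2
    simp only [hsum P] at h1
    have : 1 ≤ i.1 := by
      exact hpos i.1 i.2
    show P.1.parts.count i.1 < n + 1
    nlinarith
  have key : (pr r n : ℝ) * Real.exp (-x * n) ≤ ∏ k ∈ S, (1 - Real.exp (-x * k))⁻¹ := by
    calc (pr r n : ℝ) * Real.exp (-x * n)
        = ∑ P : T, ∏ i : S, (Real.exp (-x * (i : ℕ))) ^ (φ P i) := by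
          simp_rw [hw]
          rw [Finset.sum_const, nsmul_eq_mul, pr, Nat.card_eq_fintype_card, Finset.card_univ]
      _ = ∑ p ∈ Finset.univ.image φ, ∏ i : S, (Real.exp (-x * (i : ℕ))) ^ (p i) := by
          rw [Finset.sum_image (fun a _ b _ h => hinj h)]
      _ ≤ ∑ p ∈ Fintype.piFinset (fun _ : S => Finset.range (n+1)),
            ∏ i : S, (Real.exp (-x * (i : ℕ))) ^ (p i) := by
          apply Finset.sum_le_sum_of_subset_of_nonneg
          · intro p hp
            obtain ⟨P, -, rfl⟩ := Finset.mem_image.1 hp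
            simpa using fun a b => Nat.lt_succ_iff.1 (hle P ⟨a, b⟩)
          · intros; positivity
      _ = ∏ i : S, ∑ c ∈ Finset.range (n+1), (Real.exp (-x * (i : ℕ))) ^ c := by
          rw [Finset.prod_univ_sum]
      _ ≤ ∏ i : S, (1 - Real.exp (-x * (i : ℕ)))⁻¹ := by
          apply Finset.prod_le_prod
          · intros; positivity
          · intro i _
            apply geom_sum_le_inv _ (by positivity)
            rw [Real.exp_lt_one_iff]
            have : 1 ≤ i.1 := by
              exact hpos i.1 i.2
            have : (1:ℝ) ≤ i.1 := by exact_mod_cast this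
            nlinarith
      _ = _ := Finset.prod_coe_sort S (fun i => (1 - Real.exp (-x * (i : ℕ)))⁻¹)
  calc (pr r n : ℝ) = Real.exp (x * n) * ((pr r n : ℝ) * Real.exp (-x * n)) := by
        rw [mul_left_comm, ← Real.exp_add]; simp
    _ ≤ _ := by gcongr

/-- the function `-log(1-e^{-y})` -/
noncomputable def ff (y : ℝ) : ℝ := - Real.log (1 - Real.exp (-y))

lemma ff_anti {y z : ℝ} (hy : 0 < y) (h : y ≤ z) : ff z ≤ ff y := by
  unfold ff
  have : Real.exp (-y) < 1 := by rw [Real.exp_lt_one_iff]; linarith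
  have h2 : Real.exp (-z) ≤ Real.exp (-y) := by gcongr
  have := Real.log_le_log (x := 1 - Real.exp (-y)) (y := 1 - Real.exp (-z)) (by linarith) (by linarith)
  linarith

lemma ff_nonneg {y : ℝ} (hy : 0 < y) : 0 ≤ ff y := by
  unfold ff
  have : Real.exp (-y) < 1 := by rw [Real.exp_lt_one_iff]; linarith
  have := Real.log_nonpos (x := 1 - Real.exp (-y)) (by linarith) (by linarith [Real.exp_pos (-y)])
  linarith

lemma ff_le {y : ℝ} (hy : 0 < y) : ff y ≤ Real.log (1 + 1 / y) := by
  unfold ff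
  rw [← Real.log_inv]
  have h1 : Real.exp (-y) < 1 := by rw [Real.exp_lt_one_iff]; linarith
  apply Real.log_le_log (by apply inv_pos.2; linarith)
  have h2 : Real.exp (-y) ≤ 1 / (1 + y) := by
    rw [Real.exp_neg, ← one_div]
    apply one_div_le_one_div_of_le (by linarith)
    linarith [Real.add_one_le_exp y]
  have h3 : 1 + 1 / y = (1 - 1 / (1 + y))⁻¹ := by
    have : (1:ℝ) + y - 1 ≠ 0 := by linarith
    field_simp
    ring
  rw [h3]
  have h4 : 0 < 1 - 1 / (1 + y) := by
    rw [sub_pos, div_lt_one (by linarith)]; linarith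
  apply inv_anti₀ h4
  linarith

lemma ff_sum (y : ℝ) (hy : 0 < y) (N : ℕ) :
    ∑ l ∈ Finset.range N, ff (((l : ℝ) + 1) * y) ≤ Real.pi ^ 2 / 6 / y := by
  have h1 : ∀ l ∈ Finset.range N, HasSum (fun m : ℕ => Real.exp (-((l + 1 : ℝ) * y)) ^ (m + 1) / (m + 1))
      (ff (((l : ℝ) + 1) * y)) := by
    intro l _
    apply Real.hasSum_pow_div_log_of_abs_lt_one
    rw [abs_of_pos (Real.exp_pos _), Real.exp_lt_one_iff]
    have : 0 < ((l:ℝ) + 1) * y := by positivity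
    linarith
  have h2 := hasSum_sum h1
  have h3 : HasSum (fun m : ℕ => 1 / ((m + 1 : ℕ) : ℝ) ^ 2 / y) (Real.pi ^ 2 / 6 / y) := by
    apply HasSum.div_const
    have := (hasSum_nat_add_iff' 1).2 hasSum_zeta_two
    simpa using this
  refine hasSum_le ?_ h2 h3
  intro m
  rw [← Finset.sum_div]
  have hz : 0 < (m + 1 : ℝ) * y := by positivity
  have hE : Real.exp (-((m + 1 : ℝ) * y)) < 1 := by rw [Real.exp_lt_one_iff]; linarith
  have h4 : ∑ l ∈ Finset.range N, Real.exp (-((l + 1 : ℝ) * y)) ^ (m + 1) ≤ 1 / ((m + 1) * y) := by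
    calc ∑ l ∈ Finset.range N, Real.exp (-((l + 1 : ℝ) * y)) ^ (m + 1)
        = Real.exp (-((m + 1 : ℝ) * y)) * ∑ l ∈ Finset.range N, Real.exp (-((m + 1 : ℝ) * y)) ^ l := by
          rw [Finset.mul_sum]
          apply Finset.sum_congr rfl
          intro l _
          rw [← Real.exp_nat_mul, ← Real.exp_nat_mul, ← Real.exp_add]
          push_cast
          ring_nf
      _ ≤ Real.exp (-((m + 1 : ℝ) * y)) * (1 - Real.exp (-((m + 1 : ℝ) * y)))⁻¹ := by
          gcongr
          exact geom_sum_le_inv _ (by positivity) hE N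
      _ ≤ 1 / ((m + 1) * y) := by
          rw [← div_eq_mul_inv, div_le_div_iff₀ (by linarith) hz]
          have h5 := Real.add_one_le_exp ((m + 1 : ℝ) * y)
          have h6 : Real.exp (-((m + 1 : ℝ) * y)) * Real.exp ((m + 1 : ℝ) * y) = 1 := by
            rw [← Real.exp_add]; simp
          nlinarith [Real.exp_pos (-((m + 1 : ℝ) * y))]
  calc _ ≤ 1 / ((m + 1) * y) / ((m : ℝ) + 1) := by gcongr
    _ = _ := by push_cast; field_simp

lemma class_sum (M a N : ℕ) (hM : 0 < M) (x : ℝ) (hx : 0 < x) :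
    ∑ k ∈ (Finset.Icc 1 N).filter (fun k => k % M = a), ff (x * k)
      ≤ ff x + Real.pi ^ 2 / 6 / (M * x) := by
  classical
  let h : ℕ → ℝ := fun l => if l = 0 then ff x else ff (l * (M * x))
  have h0 : ∀ l, 0 ≤ h l := by
    intro l
    simp only [h]
    split_ifs with hl
    · exact ff_nonneg hx
    · exact ff_nonneg (by have := Nat.pos_of_ne_zero hl; positivity)
  calc _ ≤ ∑ k ∈ (Finset.Icc 1 N).filter (fun k => k % M = a), h (k / M) := by
        apply Finset.sum_le_sum
        intro k hk
        rw [Finset.mem_filter, Finset.mem_Icc] at hk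
        have hk1 : (1:ℝ) ≤ k := by exact_mod_cast hk.1.1
        simp only [h]
        split_ifs with hl
        · exact ff_anti hx (by nlinarith)
        · apply ff_anti
          · have := Nat.pos_of_ne_zero hl; positivity
          · have : ((k / M : ℕ) : ℝ) * M ≤ k := by exact_mod_cast Nat.div_mul_le_self k M
            nlinarith
    _ = ∑ l ∈ ((Finset.Icc 1 N).filter (fun k => k % M = a)).image (fun k => k / M), h l := by
        rw [Finset.sum_image]
        intro k hk k' hk' e
        simp only [Finset.coe_filter, Set.mem_ofPred_eq] at hk hk' e
        rw [← Nat.div_add_mod k M, ← Nat.div_add_mod k' M, hk.2, hk'.2, e]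
    _ ≤ ∑ l ∈ Finset.range (N + 1), h l := by
        apply Finset.sum_le_sum_of_subset_of_nonneg
        · intro l hl
          obtain ⟨k, hk, rfl⟩ := Finset.mem_image.1 hl
          rw [Finset.mem_filter, Finset.mem_Icc] at hk
          rw [Finset.mem_range]
          exact Nat.lt_succ_of_le ((Nat.div_le_self k M).trans hk.1.2)
        · intro l _ _; exact h0 l
    _ = ff x + ∑ l ∈ Finset.range N, ff (((l : ℝ) + 1) * (M * x)) := by
        rw [Finset.sum_range_succ', add_comm]
        simp [h]
    _ ≤ _ := by gcongr; exact ff_sum _ (by positivity) N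

lemma allowed_sum (r N : ℕ) (x : ℝ) (hx : 0 < x) :
    ∑ k ∈ allowed r N, ff (x * k) ≤ 3 * ff x + Real.pi ^ 2 / 2 / ((2 * r + 1) * x) := by
  classical
  have hsub : allowed r N ⊆ (Finset.Icc 1 N).filter (fun k => k % (2 * r + 1) = 0) ∪
      ((Finset.Icc 1 N).filter (fun k => k % (2 * r + 1) = r) ∪
       (Finset.Icc 1 N).filter (fun k => k % (2 * r + 1) = r + 1)) := by
    intro k hk
    simp only [allowed, Finset.mem_filter, Finset.mem_union] at hk ⊢
    tauto
  have hnn : ∀ k ∈ Finset.Icc 1 N, 0 ≤ ff (x * (k:ℕ)) := by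
    intro k hk
    have : 0 < k := (Finset.mem_Icc.1 hk).1
    exact ff_nonneg (by positivity)
  have hU : ∀ A B : Finset ℕ, A ⊆ Finset.Icc 1 N → B ⊆ Finset.Icc 1 N →
      ∑ k ∈ A ∪ B, ff (x * k) ≤ ∑ k ∈ A, ff (x * k) + ∑ k ∈ B, ff (x * k) := by
    intro A B hA hB
    rw [← Finset.sum_union_inter]
    have : 0 ≤ ∑ k ∈ A ∩ B, ff (x * k) :=
      Finset.sum_nonneg fun k hk => hnn k (hA (Finset.mem_inter.1 hk).1)
    linarith
  have e := fun a => class_sum (2 * r + 1) a N (by omega) x hx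
  have f1 := hU _ _ (Finset.filter_subset (fun k => k % (2 * r + 1) = r) _)
    (Finset.filter_subset (fun k => k % (2 * r + 1) = r + 1) (Finset.Icc 1 N))
  have f2 := hU _ _ (Finset.filter_subset (fun k => k % (2 * r + 1) = 0) (Finset.Icc 1 N))
    (Finset.union_subset (Finset.filter_subset (fun k => k % (2 * r + 1) = r) _)
    (Finset.filter_subset (fun k => k % (2 * r + 1) = r + 1) (Finset.Icc 1 N)))
  have f3 := Finset.sum_le_sum_of_subset_of_nonneg (f := fun k : ℕ => ff (x * k)) hsub (by
    intro k hk _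
    apply hnn
    simp only [Finset.mem_filter, Finset.mem_union] at hk
    tauto)
  have e0 := e 0
  have e1 := e r
  have e2 := e (r+1)
  have : Real.pi ^ 2 / 2 / ((2 * r + 1) * x) = 3 * (Real.pi ^ 2 / 6 / (((2 * r + 1 : ℕ) : ℝ) * x)) := by
    push_cast; ring
  rw [this]
  linarith

lemma pr_exp (r n N : ℕ) (hn : n ≤ N) (x : ℝ) (hx : 0 < x) :
    (pr r n : ℝ) ≤ Real.exp (x * N + 3 * ff x + Real.pi ^ 2 / 2 / ((2 * r + 1) * x)) := by
  have h1 := pr_bound r n N hn x hx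
  have h2 : ∏ k ∈ allowed r N, (1 - Real.exp (-x * k))⁻¹ = Real.exp (∑ k ∈ allowed r N, ff (x * k)) := by
    rw [Real.exp_sum]
    apply Finset.prod_congr rfl
    intro k hk
    have : 1 ≤ k := by
      rw [allowed, Finset.mem_filter, Finset.mem_Icc] at hk
      exact hk.1.1
    have : 0 < x * k := by positivity
    have h1 : Real.exp (-(x * k)) < 1 := by rw [Real.exp_lt_one_iff]; linarith
    rw [ff, Real.exp_neg, Real.exp_log (by linarith), neg_mul]
  rw [h2, ← Real.exp_add] at h1
  refine h1.trans (Real.exp_le_exp.2 ?_)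
  have := allowed_sum r N x hx
  have h3 : (n:ℝ) ≤ N := by exact_mod_cast hn
  nlinarith

lemma psi_bound (s t σ : ℤ) (r : ℕ) (hs : 2 ≤ s) (ht : 2 ≤ t) (hr : 1 ≤ r)
    (hσ : σ = 1 ∨ σ = -1) (Δ : ℚ) : ∃ K : ℕ, ∀ i j k n : ℕ, (i = 1 ∨ i = 2 ∨ i = 3 ∨ i = 4) →
      j + 1 ≤ k → psi s t σ r i j k = Δ + n → k < n + K := by
  set C : ℚ := (σ : ℚ) * (((t : ℚ) ^ 2 - 1) * ((s : ℚ) ^ 2 - 1)) / (4 * (s : ℚ) * (t : ℚ)) with hC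
  refine ⟨⌈Δ - C + 7⌉₊ + 1, ?_⟩
  intro i j k n hi hjk h
  have hj : (0 : ℚ) ≤ j := by positivity
  have hjk' : (j : ℚ) + 1 ≤ k := by exact_mod_cast hjk
  have hr' : (1 : ℚ) ≤ r := by exact_mod_cast hr
  have hs' : (2 : ℚ) ≤ s := by exact_mod_cast hs
  have ht' : (2 : ℚ) ≤ t := by exact_mod_cast ht
  have h4 : (4 : ℚ) ≤ s * t := by nlinarith
  have h1 : psi1 s t σ r j k - k - (2 * j + 1) ≤ psi s t σ r i j k := by
    rcases hi with rfl | rfl | rfl | rfl <;> simp only [psi] <;> linarith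
  have h2 : -((j : ℚ) * (j + 1)) / 4 ≤ (σ : ℚ) * ((j : ℚ) * ((j : ℚ) + 1)) / ((s : ℚ) * (t : ℚ)) := by
    have hp : 0 ≤ (j : ℚ) * (j + 1) := by positivity
    rw [div_le_div_iff₀ (by norm_num) (by linarith)]
    rcases hσ with rfl | rfl <;> push_cast <;> nlinarith
  have h3 : psi1 s t σ r j k = 1 / 2 + (σ : ℚ) * ((j : ℚ) * ((j : ℚ) + 1)) / ((s : ℚ) * (t : ℚ)) + C
      + (r * (k ^ 2 - j ^ 2 - j) + j + k ^ 2 / 2 + k / 2) := by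
    have : (r : ℚ) ≠ 0 := by linarith
    have e : ((r : ℚ) + 1 / (r : ℚ)) / 4 - (r : ℚ) * ((j : ℚ) + 1 / 2 - 1 / (2 * (r : ℚ))) ^ 2
        = 1 / 2 - r * j ^ 2 - r * j + j := by
      field_simp
      ring
    unfold psi1
    rw [← hC]
    linear_combination e
  have h5 : 0 ≤ (r : ℚ) * (k ^ 2 - j ^ 2 - j) := by
    apply mul_nonneg (by linarith)
    nlinarith
  have h6 : (j : ℚ) * (j + 1) ≤ k ^ 2 := by nlinarith
  have h7 : (k : ℚ) ≤ n + (Δ - C + 7) := by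
    nlinarith [sq_nonneg ((k : ℚ) - 5)]
  have h8 := Nat.le_ceil (Δ - C + 7)
  have h9 : (k : ℚ) ≤ ((n + ⌈Δ - C + 7⌉₊ : ℕ) : ℚ) := by push_cast; linarith
  have h10 : k ≤ n + ⌈Δ - C + 7⌉₊ := by exact_mod_cast h9
  omega

lemma eps_abs (s t : ℤ) (j : ℕ) : |eps s t j| ≤ 1 := by
  unfold eps
  split_ifs <;> simp

lemma b_bound (s t σ : ℤ) (r : ℕ) (hs : 2 ≤ s) (ht : 2 ≤ t) (hr : 1 ≤ r)
    (hσ : σ = 1 ∨ σ = -1) (Δr : ℚ) (b : ℕ → ℤ)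
    (hb : ∀ n : ℕ, b n =
      ∑ᶠ p ∈ {p : ℕ × ℕ × ℕ | (p.1 = 1 ∨ p.1 = 2 ∨ p.1 = 3 ∨ p.1 = 4) ∧
          p.2.1 + 1 ≤ p.2.2 ∧ eps s t p.2.1 ≠ 0 ∧
          psi s t σ r p.1 p.2.1 p.2.2 = Δr + (n : ℚ)},
        eps s t p.2.1 * (-1 : ℤ) ^ p.2.2 * (if p.1 = 1 ∨ p.1 = 2 then 1 else -1)) :
    ∃ K : ℕ, ∀ n, |b n| ≤ 5 * ((n : ℤ) + K) ^ 2 := by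
  obtain ⟨K, hK⟩ := psi_bound s t σ r hs ht hr hσ Δr
  refine ⟨K, fun n => ?_⟩
  have hsub : {p : ℕ × ℕ × ℕ | (p.1 = 1 ∨ p.1 = 2 ∨ p.1 = 3 ∨ p.1 = 4) ∧
          p.2.1 + 1 ≤ p.2.2 ∧ eps s t p.2.1 ≠ 0 ∧
          psi s t σ r p.1 p.2.1 p.2.2 = Δr + (n : ℚ)} ⊆
      ((Finset.range 5 ×ˢ (Finset.range (n + K) ×ˢ Finset.range (n + K)) : Finset (ℕ × ℕ × ℕ)) :
        Set (ℕ × ℕ × ℕ)) := by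
    rintro ⟨i, j, k⟩ ⟨h1, h2, h3, h4⟩
    simp only at h1 h2 h3 h4
    have := hK i j k n h1 h2 h4
    simp only [Finset.coe_product, Set.mem_prod, Finset.coe_range, Set.mem_Iio]
    omega
  have hfin := (Finset.finite_toSet _).subset hsub
  rw [hb, finsum_mem_eq_finite_toFinset_sum _ hfin]
  refine (Finset.abs_sum_le_sum_abs _ _).trans ?_
  have h1 : ∀ p ∈ hfin.toFinset,
      |eps s t p.2.1 * (-1 : ℤ) ^ p.2.2 * (if p.1 = 1 ∨ p.1 = 2 then 1 else -1)| ≤ 1 := by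
    intro p _
    rw [abs_mul, abs_mul, abs_neg_one_pow]
    have := eps_abs s t p.2.1
    split_ifs <;> simpa using this
  refine (Finset.sum_le_card_nsmul _ _ _ h1).trans ?_
  have h2 : hfin.toFinset.card ≤ 5 * (n + K) ^ 2 := by
    refine (Finset.card_le_card (fun p hp => ?_)).trans_eq
      (b := (Finset.range 5 ×ˢ (Finset.range (n + K) ×ˢ Finset.range (n + K))).card) ?_
    · exact hsub (by simpa using hp)
    · simp only [Finset.card_product, Finset.card_range]; ring
  rw [nsmul_eq_mul, mul_one]
  exact_mod_cast h2

lemma c_bound (r : ℕ) (hr : 1 ≤ r) (b c : ℕ → ℤ) (K : ℕ)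
    (hb : ∀ n, |b n| ≤ 5 * ((n : ℤ) + K) ^ 2)
    (hc : ∀ n : ℕ, c n = ∑ m ∈ Finset.range (n + 1), (pr r (n - m) : ℤ) * b m)
    (n : ℕ) (hn : 1 ≤ n) :
    |(c n : ℝ)| ≤ Real.exp (2 * Real.pi / √(2 * (2 * r + 1)) * √n) *
      ((10 * (1 + K) ^ 2 * (2 * r + 2) ^ 3) * (n : ℝ) ^ 6) := by
  have hn' : (1 : ℝ) ≤ n := by exact_mod_cast hn
  have hr' : (1 : ℝ) ≤ r := by exact_mod_cast hr
  set M : ℝ := 2 * r + 1 with hM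
  have hM3 : 3 ≤ M := by linarith
  set u := √(2 * M) with hu
  set v := √(n : ℝ) with hv
  have hu0 : 0 < u := Real.sqrt_pos.2 (by linarith)
  have hv0 : 0 < v := Real.sqrt_pos.2 (by linarith)
  have hu2 : u ^ 2 = 2 * M := Real.sq_sqrt (by linarith)
  have hv2 : v ^ 2 = n := Real.sq_sqrt (by linarith)
  have hpi := Real.pi_pos
  have hpi3 := Real.pi_gt_three
  set x : ℝ := Real.pi / (u * v) with hx
  have hx0 : 0 < x := by positivity
  have hE : x * n + Real.pi ^ 2 / 2 / (M * x) = 2 * Real.pi / u * v := by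
    have : M = u ^ 2 / 2 := by linarith
    rw [this, ← hv2, hx]
    field_simp
    ring
  have hff : Real.exp (3 * ff x) ≤ ((M + 1) * n) ^ 3 := by
    have h1 : Real.exp (ff x) ≤ (M + 1) * n := by
      have h2 : Real.exp (ff x) ≤ 1 + 1 / x := by
        rw [← Real.exp_log (show 0 < 1 + 1 / x by positivity)]
        exact Real.exp_le_exp.2 (ff_le hx0)
      have h3 : 1 / x ≤ M * n := by
        rw [hx, one_div_div, div_le_iff₀ hpi]
        have h4 : u ≤ M := by
          apply Real.sqrt_le_iff.2
          constructor <;> nlinarith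
        have h5 : v ≤ n := by
          apply Real.sqrt_le_iff.2
          constructor <;> nlinarith
        have h6 : u * v ≤ M * n := by gcongr
        have : 0 ≤ M * n := by positivity
        nlinarith
      linarith
    have : Real.exp (3 * ff x) = Real.exp (ff x) ^ 3 := by
      rw [← Real.exp_nat_mul]; norm_num
    rw [this]
    gcongr
  have hpr : ∀ m : ℕ, (pr r (n - m) : ℝ) ≤ Real.exp (2 * Real.pi / u * v) * ((M + 1) * n) ^ 3 := by
    intro m
    refine (pr_exp r (n - m) n (Nat.sub_le _ _) x hx0).trans ?_
    rw [show x * n + 3 * ff x + Real.pi ^ 2 / 2 / ((2 * r + 1) * x) =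
      (2 * Real.pi / u * v) + 3 * ff x by rw [← hE]; ring, Real.exp_add]
    gcongr
  have hK0 : (0 : ℝ) ≤ K := by positivity
  have hbr : ∀ m ∈ Finset.range (n + 1), |(b m : ℝ)| ≤ 5 * ((1 + K) * n) ^ 2 := by
    intro m hm
    have hm' : (m : ℝ) ≤ n := by
      exact_mod_cast Nat.lt_succ_iff.1 (Finset.mem_range.1 hm)
    have h1 : |(b m : ℝ)| ≤ 5 * ((m : ℝ) + K) ^ 2 := by exact_mod_cast hb m
    refine h1.trans ?_
    gcongr
    nlinarith
  rw [hc]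
  push_cast
  calc _ ≤ ∑ m ∈ Finset.range (n + 1), |(pr r (n - m) : ℝ) * (b m : ℝ)| := Finset.abs_sum_le_sum_abs _ _
    _ ≤ ∑ m ∈ Finset.range (n + 1), (Real.exp (2 * Real.pi / u * v) * ((M + 1) * n) ^ 3) *
          (5 * ((1 + K) * n) ^ 2) := by
        apply Finset.sum_le_sum
        intro m hm
        rw [abs_mul, Nat.abs_cast]
        exact mul_le_mul (hpr m) (hbr m hm) (abs_nonneg _) (by positivity)
    _ = (n + 1) * ((Real.exp (2 * Real.pi / u * v) * ((M + 1) * n) ^ 3) *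
          (5 * ((1 + K) * n) ^ 2)) := by simp
    _ ≤ (2 * n) * ((Real.exp (2 * Real.pi / u * v) * ((M + 1) * n) ^ 3) *
          (5 * ((1 + K) * n) ^ 2)) := by
        gcongr
        linarith
    _ = _ := by rw [hM]; ring

lemma tendsto_main (L a : ℝ) :
    Tendsto (fun n : ℕ => (L * √(n : ℝ) + a + 6 * Real.log n) ^ 2 / n) atTop (nhds (L ^ 2)) := by
  have h1 : Tendsto (fun y : ℝ => Real.log y / y ^ (1 / 2 : ℝ)) atTop (nhds 0) :=
    (isLittleO_log_rpow_atTop (by norm_num)).tendsto_div_nhds_zero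
  have h2 := h1.comp (tendsto_natCast_atTop_atTop (R := ℝ))
  have h3 : Tendsto (fun n : ℕ => (√(n : ℝ))⁻¹) atTop (nhds 0) :=
    (Real.tendsto_sqrt_atTop.comp tendsto_natCast_atTop_atTop).inv_tendsto_atTop
  have h4 := (((h3.const_mul a).add (h2.const_mul 6)).const_add L).pow 2
  simp only [mul_zero, add_zero] at h4
  refine h4.congr' ?_
  filter_upwards [eventually_ge_atTop 1] with n hn
  have hn' : (0 : ℝ) < n := by exact_mod_cast hn
  have hv0 : 0 < √(n : ℝ) := Real.sqrt_pos.2 hn'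
  have hv2 : √(n : ℝ) ^ 2 = n := Real.sq_sqrt hn'.le
  simp only [Function.comp, ← Real.sqrt_eq_rpow]
  have e : L * √(n : ℝ) + a + 6 * Real.log n =
      √(n : ℝ) * (L + (a * (√(n : ℝ))⁻¹ + 6 * (Real.log n / √(n : ℝ)))) := by
    field_simp
    ring
  rw [e, mul_pow, hv2, mul_div_cancel_left₀ _ hn'.ne']

/-- With `Δ_r` as in the regularized `+1/r`-surgery formula, the coefficients
`c n = ∑_{m≤n} p_r(n−m)·b m` of `Ẑ(Σ̄(s,t,rst±1); q)` satisfy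
`limsup (log|c n|)²/n ≤ 2π²/(2r+1)`, i.e. the effective central charge is at most
`3/(2r+1)`. -/
theorem stmt8 (s t σ : ℤ) (r : ℕ) (hs : 2 ≤ s) (ht : 2 ≤ t) (hst : IsCoprime s t)
    (hr : 1 ≤ r) (hσ : σ = 1 ∨ σ = -1)
    (j₀ : ℚ) (hj₀ : j₀ = ((s : ℚ) * (t : ℚ) - (s : ℚ) - (t : ℚ) - 1) / 2)
    (Δr : ℚ)
    (hΔr : Δr = ((r : ℚ) + 1 / (r : ℚ)) / 4
      + (σ : ℚ) * (j₀ * (j₀ + 1)) / ((s : ℚ) * (t : ℚ))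
      + (σ : ℚ) * (((t : ℚ) ^ 2 - 1) * ((s : ℚ) ^ 2 - 1)) / (4 * (s : ℚ) * (t : ℚ))
      - (r : ℚ) * (j₀ + 1 / 2 + 1 / (2 * (r : ℚ))) ^ 2
      + ((2 * (r : ℚ) + 1) * (j₀ + 1) ^ 2 - (j₀ + 1)) / 2)
    (b : ℕ → ℤ)
    (hb : ∀ n : ℕ, b n =
      ∑ᶠ p ∈ {p : ℕ × ℕ × ℕ | (p.1 = 1 ∨ p.1 = 2 ∨ p.1 = 3 ∨ p.1 = 4) ∧
          p.2.1 + 1 ≤ p.2.2 ∧ eps s t p.2.1 ≠ 0 ∧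
          psi s t σ r p.1 p.2.1 p.2.2 = Δr + (n : ℚ)},
        eps s t p.2.1 * (-1 : ℤ) ^ p.2.2 * (if p.1 = 1 ∨ p.1 = 2 then 1 else -1))
    (c : ℕ → ℤ)
    (hc : ∀ n : ℕ, c n = ∑ m ∈ Finset.range (n + 1), (pr r (n - m) : ℤ) * b m) :
    limsup (fun n : ℕ => (Real.log |(c n : ℝ)|) ^ 2 / n) atTop
      ≤ 2 * Real.pi ^ 2 / (2 * (r : ℝ) + 1) := by
  obtain ⟨K, hK⟩ := b_bound s t σ r hs ht hr hσ Δr b hb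
  have hcb := c_bound r hr b c K hK hc
  set L : ℝ := 2 * Real.pi / √(2 * (2 * r + 1)) with hL
  set A : ℝ := 10 * (1 + K) ^ 2 * (2 * r + 2) ^ 3 with hA
  have hA1 : 1 ≤ A := by
    have h1 : (1 : ℝ) ≤ (1 + K) ^ 2 := one_le_pow₀ (by linarith [Nat.cast_nonneg (α := ℝ) K])
    have h2 : (1 : ℝ) ≤ (2 * r + 2) ^ 3 := one_le_pow₀ (by linarith [Nat.cast_nonneg (α := ℝ) r])
    rw [hA]
    nlinarith
  have hL0 : 0 ≤ L := by have := Real.pi_pos; positivity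
  have hL2 : L ^ 2 = 2 * Real.pi ^ 2 / (2 * (r : ℝ) + 1) := by
    rw [hL, div_pow, Real.sq_sqrt (by positivity)]
    field_simp
  have ht := tendsto_main L (Real.log A)
  rw [← hL2, ← ht.limsup_eq]
  apply limsup_le_limsup
  · filter_upwards [eventually_ge_atTop 1] with n hn
    have hn' : (1 : ℝ) ≤ n := by exact_mod_cast hn
    have hlogn : 0 ≤ Real.log n := Real.log_nonneg hn'
    have hlogA : 0 ≤ Real.log A := Real.log_nonneg hA1
    by_cases h0 : c n = 0
    · simp only [h0, Int.cast_zero, abs_zero, Real.log_zero]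
      rw [zero_pow two_ne_zero, zero_div]
      positivity
    · have h1 : (1 : ℝ) ≤ |(c n : ℝ)| := by exact_mod_cast Int.one_le_abs h0
      have h2 : 0 ≤ Real.log |(c n : ℝ)| := Real.log_nonneg h1
      have h3 : Real.log |(c n : ℝ)| ≤ L * √(n : ℝ) + Real.log A + 6 * Real.log n := by
        refine (Real.log_le_log (by linarith) (hcb n hn)).trans_eq ?_
        rw [Real.log_mul (by positivity) (by positivity), Real.log_exp,
          Real.log_mul (by positivity) (by positivity), Real.log_pow]
        push_cast
        ring
      gcongr
  · refine IsBoundedUnder.isCoboundedUnder_le ⟨0, ?_⟩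
    simp only [eventually_map]
    exact Eventually.of_forall fun n => by positivity
  · exact ht.isBoundedUnder_le
end

section
/- Let s ≥ 1, let M be a symmetric s×s integer matrix that is negative definite (as a real matrix), let a ∈ ℤ^s, and let deg : {1,…,s} → ℕ with η := max_v deg(v) ≥ 3. With χ_a(x) = −(xᵀMx + xᵀa)/2, D_j = {x ∈ ℤ^s : 2χ_a(x) = j}, and c_j = Σ_{x ∈ D_j} Π_{v=1}^{s} F̂_{deg(v)}((2Mx + a)_v), and with p(n) the number of partitions of n, the convolution d_n = Σ_{m=0}^{n} p(n−m)·c_m satisfies limsup_{n→∞} (log|d_n|)²/n ≤ 2π²/3. That is, for a negative definite plumbed manifold M₃, the effective central charge of Ẑ_a(M₃; q)/(q;q)_∞ is at most 1. -/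
open Matrix Filter

/-- The weights `F̂_n(k)` of the `Ẑ`-invariant of a negative definite plumbed manifold. -/
def Fhat (n : ℕ) (k : ℤ) : ℚ :=
  if (n = 0 ∧ (k = -2 ∨ k = 2)) ∨ (n = 1 ∧ k = -1) ∨ (n = 2 ∧ k = 0) then 1
  else if n = 0 ∧ k = 0 then -2
  else if n = 1 ∧ k = 1 then -1
  else if 3 ≤ n ∧ (n : ℤ) - 2 ≤ |k| ∧ k % 2 = (n : ℤ) % 2 then
    (1 / 2) * ((k.sign : ℚ)) ^ n * (Nat.choose ((n + k.natAbs) / 2 - 2) (n - 3) : ℚ)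
  else 0


theorem part_gen (n : ℕ) (x : ℝ) (hx0 : 0 < x) :
    (Fintype.card (Nat.Partition n) : ℝ) * x ^ n ≤
      ∏ k : Fin n, ∑ j ∈ Finset.range (n + 1), x ^ (((k : ℕ) + 1) * j) := by
  classical
  rw [Finset.prod_univ_sum]
  let e : Nat.Partition n → (Fin n → ℕ) := fun p k => p.parts.count ((k : ℕ) + 1)
  have hcount : ∀ (p : Nat.Partition n), ∑ k : Fin n, ((k : ℕ) + 1) * e p k = n := by
    intro p
    have h1 : ∑ m ∈ p.parts.toFinset, p.parts.count m • m = p.parts.sum :=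
      (Finset.sum_multiset_count p.parts).symm
    rw [p.parts_sum] at h1
    have h2 : ∑ m ∈ p.parts.toFinset, p.parts.count m • m
        = ∑ m ∈ Finset.Ico 1 (n + 1), p.parts.count m • m := by
      apply Finset.sum_subset
      · intro m hm
        rw [Multiset.mem_toFinset] at hm
        have := p.parts_pos hm
        have h3 := Multiset.le_sum_of_mem hm
        rw [p.parts_sum] at h3
        simp; omega
      · intro m _ hm
        rw [Multiset.mem_toFinset] at hm
        simp [Multiset.count_eq_zero_of_notMem hm]
    rw [h2, Finset.sum_Ico_eq_sum_range, Finset.sum_range] at h1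
    simp only [e]
    refine Eq.trans (Finset.sum_congr rfl fun k _ => ?_) h1
    rw [smul_eq_mul, mul_comm, add_comm 1]
  have hinj : Function.Injective e := by
    intro p q h
    apply Nat.Partition.ext
    ext m
    by_cases hm : 1 ≤ m ∧ m ≤ n
    · have := congrFun h ⟨m - 1, by omega⟩
      simp only [e] at this
      rwa [Nat.sub_add_cancel hm.1] at this
    · have key : ∀ r : Nat.Partition n, m ∉ r.parts := by
        intro r hr
        have := r.parts_pos hr
        have h3 := Multiset.le_sum_of_mem hr
        rw [r.parts_sum] at h3
        omega
      rw [Multiset.count_eq_zero_of_notMem (key p), Multiset.count_eq_zero_of_notMem (key q)]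
  have hterm : ∀ p : Nat.Partition n, ∏ k : Fin n, x ^ (((k : ℕ) + 1) * e p k) = x ^ n := by
    intro p
    rw [Finset.prod_pow_eq_pow_sum, hcount]
  calc (Fintype.card (Nat.Partition n) : ℝ) * x ^ n
      = ∑ p : Nat.Partition n, ∏ k : Fin n, x ^ (((k : ℕ) + 1) * e p k) := by
        simp [hterm]
    _ = ∑ f ∈ Finset.univ.image e, ∏ k : Fin n, x ^ (((k : ℕ) + 1) * f k) := by
        rw [Finset.sum_image (fun a _ b _ h => hinj h)]
    _ ≤ _ := by
        apply Finset.sum_le_sum_of_subset_of_nonneg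
        · intro f hf
          obtain ⟨p, -, rfl⟩ := Finset.mem_image.1 hf
          rw [Fintype.mem_piFinset]
          intro k
          rw [Finset.mem_range]
          have := Finset.single_le_sum (f := fun k : Fin n => ((k : ℕ) + 1) * e p k)
            (fun _ _ => Nat.zero_le _) (Finset.mem_univ k)
          rw [hcount] at this
          nlinarith
        · intro f _ _
          positivity

theorem part_log (n : ℕ) (t : ℝ) (ht : 0 < t) :
    ∑ k : Fin n, -Real.log (1 - Real.exp (-t) ^ ((k : ℕ) + 1)) ≤ Real.pi ^ 2 / 6 / t := by
  set x := Real.exp (-t) with hx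
  have hx0 : 0 < x := Real.exp_pos _
  have hx1 : x < 1 := by rw [hx, Real.exp_lt_one_iff]; linarith
  have h1 : ∀ k ∈ (Finset.univ : Finset (Fin n)),
      HasSum (fun m : ℕ => (x ^ ((k : ℕ) + 1)) ^ (m + 1) / ((m : ℝ) + 1))
      (-Real.log (1 - x ^ ((k : ℕ) + 1))) := by
    intro k _
    apply Real.hasSum_pow_div_log_of_abs_lt_one
    rw [abs_of_pos (by positivity)]
    exact pow_lt_one₀ hx0.le hx1 (by omega)
  have h2 := hasSum_sum h1
  have h3 : HasSum (fun m : ℕ => (1 : ℝ) / ((m : ℝ) + 1) ^ 2 / t) (Real.pi ^ 2 / 6 / t) := by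
    have := hasSum_zeta_two
    rw [← hasSum_nat_add_iff' 1] at this
    simpa using this.div_const t
  apply hasSum_le _ h2 h3
  intro m
  have hy0 : 0 < x ^ (m + 1) := by positivity
  have hy1 : x ^ (m + 1) < 1 := pow_lt_one₀ hx0.le hx1 (by omega)
  have hgeo : ∑ k : Fin n, (x ^ ((k : ℕ) + 1)) ^ (m + 1) ≤ 1 / (((m : ℝ) + 1) * t) := by
    have e1 : ∑ k : Fin n, (x ^ ((k : ℕ) + 1)) ^ (m + 1)
        = x ^ (m + 1) * ∑ k ∈ Finset.range n, (x ^ (m + 1)) ^ k := by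
      rw [Finset.sum_range, Finset.mul_sum]
      apply Finset.sum_congr rfl
      intro k _
      ring
    rw [e1, geom_sum_eq hy1.ne]
    have e2 : x ^ (m + 1) = (Real.exp (((m : ℝ) + 1) * t))⁻¹ := by
      rw [hx, ← Real.exp_nat_mul, ← Real.exp_neg]; push_cast; ring_nf
    have e3 : ((m : ℝ) + 1) * t + 1 ≤ Real.exp (((m : ℝ) + 1) * t) := Real.add_one_le_exp _
    have e4 : x ^ (m + 1) * (((m : ℝ) + 1) * t + 1) ≤ 1 := by
      rw [e2]
      rw [inv_mul_le_iff₀ (Real.exp_pos _)]; linarith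
    have hp : 0 < ((m : ℝ) + 1) * t := by positivity
    generalize x ^ (m + 1) = y at *
    generalize ((m : ℝ) + 1) * t = u at *
    have hyn : 0 ≤ y ^ n := by positivity
    rw [show y * ((y ^ n - 1) / (y - 1)) = y * (1 - y ^ n) / (1 - y) by
      rw [← neg_div_neg_eq, neg_sub, neg_sub, mul_div_assoc]]
    rw [div_le_div_iff₀ (by linarith) hp]
    have : y * (1 - y ^ n) * u ≤ y * u := by
      have : 0 ≤ y * u * y ^ n := by positivity
      nlinarith
    nlinarith
  rw [← Finset.sum_div]
  calc _ ≤ 1 / (((m : ℝ) + 1) * t) / ((m : ℝ) + 1) := by gcongr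
    _ = _ := by field_simp

theorem part_bound (n : ℕ) :
    (Fintype.card (Nat.Partition n) : ℝ) ≤ Real.exp (Real.pi * √(2 / 3) * √n) := by
  rcases Nat.eq_zero_or_pos n with rfl | hn
  · simp
  have hnR : (0 : ℝ) < n := by exact_mod_cast hn
  have key : ∀ t : ℝ, 0 < t →
      (Fintype.card (Nat.Partition n) : ℝ) ≤ Real.exp (Real.pi ^ 2 / 6 / t + n * t) := by
    intro t ht
    have h1 := part_gen n (Real.exp (-t)) (Real.exp_pos _)
    have h2 := part_log n t ht
    set x := Real.exp (-t) with hx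
    have hx0 : 0 < x := Real.exp_pos _
    have hx1 : x < 1 := by rw [hx, Real.exp_lt_one_iff]; linarith
    have h3 : ∏ k : Fin n, ∑ j ∈ Finset.range (n + 1), x ^ (((k : ℕ) + 1) * j)
        ≤ Real.exp (Real.pi ^ 2 / 6 / t) := by
      calc _ ≤ ∏ k : Fin n, Real.exp (-Real.log (1 - x ^ ((k : ℕ) + 1))) := by
            apply Finset.prod_le_prod
            · intros; positivity
            · intro k _
              have hy0 : 0 < x ^ ((k : ℕ) + 1) := by positivity
              have hy1 : x ^ ((k : ℕ) + 1) < 1 := pow_lt_one₀ hx0.le hx1 (by omega)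
              rw [Real.exp_neg, Real.exp_log (by linarith)]
              simp_rw [pow_mul]
              rw [← tsum_geometric_of_lt_one hy0.le hy1]
              exact (summable_geometric_of_lt_one hy0.le hy1).sum_le_tsum _
                (fun _ _ => by positivity)
        _ = Real.exp (∑ k : Fin n, -Real.log (1 - x ^ ((k : ℕ) + 1))) := by
            rw [Real.exp_sum]
        _ ≤ _ := Real.exp_le_exp.2 h2
    have h4 := h1.trans h3
    have h5 : x ^ n * Real.exp (n * t) = 1 := by
      rw [hx, ← Real.exp_nat_mul, ← Real.exp_add]; simp
    rw [Real.exp_add]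
    calc (Fintype.card (Nat.Partition n) : ℝ)
        = (Fintype.card (Nat.Partition n) : ℝ) * x ^ n * Real.exp (n * t) := by
          rw [mul_assoc, h5, mul_one]
      _ ≤ _ := by gcongr
  have hs : 0 < √(n : ℝ) := Real.sqrt_pos.2 hnR
  have h6 : 0 < √(2 / 3 : ℝ) := Real.sqrt_pos.2 (by norm_num)
  have hs2 : √(n : ℝ) ^ 2 = n := Real.sq_sqrt hnR.le
  have h62 : √(2 / 3 : ℝ) ^ 2 = 2 / 3 := Real.sq_sqrt (by norm_num)
  refine (key (Real.pi * √(2/3) / (2 * √n)) (by positivity)).trans (le_of_eq ?_)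
  congr 1
  generalize √(n : ℝ) = r at *
  generalize √(2 / 3 : ℝ) = w at *
  rw [← hs2]
  have := Real.pi_pos
  field_simp
  nlinarith [h62]

theorem Fhat_int (n : ℕ) (k : ℤ) : ∃ z : ℤ, 2 * Fhat n k = z := by
  unfold Fhat
  split_ifs
  · exact ⟨2, by norm_num⟩
  · exact ⟨-4, by norm_num⟩
  · exact ⟨-2, by norm_num⟩
  · exact ⟨k.sign ^ n * (Nat.choose ((n + k.natAbs) / 2 - 2) (n - 3) : ℤ), by push_cast; ring⟩
  · exact ⟨0, by norm_num⟩

theorem Fhat_bound (n η : ℕ) (hn : n ≤ η) (k : ℤ) (K : ℕ) (hk : k.natAbs ≤ K) :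
    |Fhat n k| ≤ 2 * ((η + K + 1 : ℕ) : ℚ) ^ η := by
  have h1 : (1 : ℚ) ≤ ((η + K + 1 : ℕ) : ℚ) ^ η := by
    apply one_le_pow₀; push_cast
    have : (0:ℚ) ≤ η := by positivity
    have : (0:ℚ) ≤ K := by positivity
    linarith
  unfold Fhat
  split_ifs
  · norm_num; push_cast at h1; linarith
  · norm_num; push_cast at h1; linarith
  · norm_num; push_cast at h1; linarith
  · rw [abs_mul, abs_mul, abs_pow]
    have hs : |(k.sign : ℚ)| ≤ 1 := by
      rcases Int.sign_trichotomy k with h | h | h <;> simp [h]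
    have hs' : |(k.sign : ℚ)| ^ n ≤ 1 := pow_le_one₀ (abs_nonneg _) hs
    have hch : Nat.choose ((n + k.natAbs) / 2 - 2) (n - 3) ≤ (η + K + 1) ^ η :=
      calc _ ≤ ((n + k.natAbs) / 2 - 2) ^ (n - 3) := Nat.choose_le_pow _ _
        _ ≤ (η + K + 1) ^ (n - 3) := Nat.pow_le_pow_left (by omega) _
        _ ≤ _ := Nat.pow_le_pow_right (by omega) (by omega)
    have hch' : (Nat.choose ((n + k.natAbs) / 2 - 2) (n - 3) : ℚ) ≤ ((η + K + 1 : ℕ) : ℚ) ^ η := by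
      exact_mod_cast hch
    rw [abs_of_nonneg (by positivity : (0:ℚ) ≤ (Nat.choose ((n + k.natAbs) / 2 - 2) (n - 3) : ℚ))]
    rw [abs_of_nonneg (by norm_num : (0:ℚ) ≤ 1/2)]
    calc _ ≤ 2 * 1 * ((η + K + 1 : ℕ) : ℚ) ^ η := by gcongr; norm_num
      _ = _ := by ring
  · norm_num; push_cast at h1; linarith

theorem posdef_bound (s : ℕ) (hs : 1 ≤ s) (M : Matrix (Fin s) (Fin s) ℝ)
    (hneg : ∀ x : Fin s → ℝ, x ≠ 0 → x ⬝ᵥ (M *ᵥ x) < 0) :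
    ∃ l : ℝ, 0 < l ∧ ∀ x : Fin s → ℝ, l * ‖x‖ ^ 2 ≤ -(x ⬝ᵥ (M *ᵥ x)) := by
  have : Nonempty (Fin s) := ⟨⟨0, hs⟩⟩
  have hcont : Continuous (fun x : Fin s → ℝ => -(x ⬝ᵥ (M *ᵥ x))) := by
    fun_prop
  obtain ⟨y, hy, hmin⟩ := (isCompact_sphere (0 : Fin s → ℝ) 1).exists_isMinOn
    (NormedSpace.sphere_nonempty.2 zero_le_one) hcont.continuousOn
  have hy1 : ‖y‖ = 1 := by simpa using hy
  refine ⟨-(y ⬝ᵥ (M *ᵥ y)), ?_, ?_⟩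
  · have := hneg y (by rintro rfl; simp at hy1)
    linarith
  · intro x
    by_cases hx : x = 0
    · simp [hx]
    have hxn : 0 < ‖x‖ := norm_pos_iff.2 hx
    have h := hmin (show ‖x‖⁻¹ • x ∈ Metric.sphere (0 : Fin s → ℝ) 1 by
      simp [norm_smul, hxn.ne'])
    simp only [Set.mem_ofPred_eq] at h
    rw [mulVec_smul, smul_dotProduct, dotProduct_smul, smul_eq_mul, smul_eq_mul] at h
    calc _ ≤ -(‖x‖⁻¹ * (‖x‖⁻¹ * (x ⬝ᵥ (M *ᵥ x)))) * ‖x‖ ^ 2 := by gcongr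
      _ = _ := by field_simp

theorem box_bound (s : ℕ) (hs : 1 ≤ s) (M : Matrix (Fin s) (Fin s) ℤ)
    (hneg : ∀ x : Fin s → ℝ, x ≠ 0 → x ⬝ᵥ ((M.map ((↑) : ℤ → ℝ)) *ᵥ x) < 0)
    (a : Fin s → ℤ) :
    ∃ B : ℕ, ∀ (j : ℕ) (x : Fin s → ℤ), -(x ⬝ᵥ (M *ᵥ x) + x ⬝ᵥ a) = (j : ℤ) →
      ∀ v, (x v).natAbs ≤ B * (j + 1) := by
  obtain ⟨l, hl, hb⟩ := posdef_bound s hs _ hneg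
  set A : ℝ := ∑ v, |(a v : ℝ)| with hA
  have hA0 : 0 ≤ A := by positivity
  obtain ⟨B, hB⟩ := exists_nat_ge ((1 + A) / l)
  refine ⟨B, fun j x hx v => ?_⟩
  let X : Fin s → ℝ := fun v => (x v : ℝ)
  have hX := hb X
  have hxR : -(X ⬝ᵥ ((M.map ((↑) : ℤ → ℝ)) *ᵥ X) + X ⬝ᵥ (fun v => (a v : ℝ))) = (j : ℝ) := by
    have := congrArg (fun z : ℤ => (z : ℝ)) hx
    simp only [dotProduct, mulVec] at this ⊢
    push_cast at this
    simpa [X] using this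
  have hda : |X ⬝ᵥ (fun v => (a v : ℝ))| ≤ ‖X‖ * A := by
    rw [dotProduct, hA, Finset.mul_sum]
    refine (Finset.abs_sum_le_sum_abs _ _).trans (Finset.sum_le_sum fun i _ => ?_)
    rw [abs_mul]
    gcongr
    exact norm_le_pi_norm X i
  have hXv : |(x v : ℝ)| ≤ ‖X‖ := norm_le_pi_norm X v
  have hfin : ‖X‖ ≤ B * ((j : ℝ) + 1) := by
    have hj : (0:ℝ) ≤ j := by positivity
    rcases eq_or_ne X 0 with h0 | h0
    · rw [h0, norm_zero]; positivity
    have h1 : 1 ≤ ‖X‖ := by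
      obtain ⟨i, hi⟩ := Function.ne_iff.1 h0
      have hi' : x i ≠ 0 := by simpa [X] using hi
      refine le_trans ?_ (norm_le_pi_norm X i)
      have : (1 : ℤ) ≤ |x i| := Int.one_le_abs hi'
      simp only [X, Real.norm_eq_abs]
      exact_mod_cast this
    have h2 : l * ‖X‖ ^ 2 ≤ j + ‖X‖ * A := by
      have := neg_abs_le (X ⬝ᵥ (fun v => (a v : ℝ)))
      have := le_abs_self (X ⬝ᵥ (fun v => (a v : ℝ)))
      linarith
    have h3 : l * ‖X‖ ≤ j + A := by
      have : ‖X‖ * (l * ‖X‖) ≤ ‖X‖ * (j + A) := by nlinarith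
      exact le_of_mul_le_mul_left this (by linarith)
    rw [div_le_iff₀ hl] at hB
    have : l * ‖X‖ ≤ l * (B * ((j : ℝ) + 1)) := by nlinarith
    exact le_of_mul_le_mul_left this hl
  have := hXv.trans hfin
  have h4 : ((x v).natAbs : ℝ) = |(x v : ℝ)| := by
    rw [Nat.cast_natAbs]; push_cast; rfl
  rw [← h4] at this
  exact_mod_cast this

theorem c_int (s : ℕ) (M : Matrix (Fin s) (Fin s) ℤ) (a : Fin s → ℤ) (deg : Fin s → ℕ)
    (S : Set (Fin s → ℤ)) : ∃ z : ℤ, 2 ^ s *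
      (∑ᶠ x ∈ S, ∏ v : Fin s, Fhat (deg v) (2 * (M *ᵥ x) v + a v)) = z := by
  refine finsum_mem_induction (fun q : ℚ => ∃ z : ℤ, 2 ^ s * q = z) ⟨0, by simp⟩ ?_ ?_
  · rintro p q ⟨z, hz⟩ ⟨w, hw⟩
    exact ⟨z + w, by rw [mul_add, hz, hw]; push_cast; rfl⟩
  · intro x _
    choose z hz using fun v => Fhat_int (deg v) (2 * (M *ᵥ x) v + a v)
    refine ⟨∏ v, z v, ?_⟩
    push_cast
    simp_rw [← hz]
    rw [Finset.prod_mul_distrib]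
    simp

theorem c_bound_s13 (s : ℕ) (hs : 1 ≤ s) (M : Matrix (Fin s) (Fin s) ℤ)
    (hneg : ∀ x : Fin s → ℝ, x ≠ 0 → x ⬝ᵥ ((M.map ((↑) : ℤ → ℝ)) *ᵥ x) < 0)
    (a : Fin s → ℤ) (deg : Fin s → ℕ) (η : ℕ)
    (hηmax : ∀ v, deg v ≤ η) :
    ∃ C K : ℕ, 1 ≤ C ∧ ∀ j : ℕ, 
      |∑ᶠ x ∈ {x : Fin s → ℤ | -(x ⬝ᵥ (M *ᵥ x) + x ⬝ᵥ a) = (j : ℤ)},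
        ∏ v : Fin s, Fhat (deg v) (2 * (M *ᵥ x) v + a v)| ≤ (C : ℚ) * ((j : ℚ) + 1) ^ K := by
  classical
  obtain ⟨B, hB⟩ := box_bound s hs M hneg a
  let Q : ℕ := ∑ v, ∑ w, (M v w).natAbs
  let A : ℕ := ∑ v, (a v).natAbs
  let E : ℕ := η + (2 * (Q * B) + A) + 1
  refine ⟨(2 * B + 1) ^ s * (2 * E ^ η) ^ s, s + η * s, ?_, ?_⟩
  · have : 0 < E := by simp only [E]; omega
    exact Nat.succ_le_of_lt (by positivity)
  intro j
  let R : ℕ := B * (j + 1)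
  let T : Finset (Fin s → ℤ) := Fintype.piFinset (fun _ => Finset.Icc (-(R : ℤ)) R)
  let S : Finset (Fin s → ℤ) := T.filter (fun x => -(x ⬝ᵥ (M *ᵥ x) + x ⬝ᵥ a) = (j : ℤ))
  have hS : {x : Fin s → ℤ | -(x ⬝ᵥ (M *ᵥ x) + x ⬝ᵥ a) = (j : ℤ)} = ↑S := by
    ext x
    simp only [S, T, Set.mem_ofPred_eq, Finset.coe_filter, Fintype.mem_piFinset, Finset.mem_Icc]
    refine ⟨fun h => ⟨fun v => ?_, h⟩, fun h => h.2⟩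
    have := hB j x h v
    simp only [R]
    omega
  have hcard : S.card ≤ ((2 * B + 1) * (j + 1)) ^ s := by
    refine (Finset.card_filter_le _ _).trans ?_
    simp only [T, Fintype.card_piFinset, Int.card_Icc, Finset.prod_const, Finset.card_univ,
      Fintype.card_fin]
    apply Nat.pow_le_pow_left
    have : (R : ℤ) + 1 - -(R : ℤ) = ((2 * R + 1 : ℕ) : ℤ) := by push_cast; ring
    rw [this, Int.toNat_natCast]
    simp only [R]
    nlinarith
  have hterm : ∀ x ∈ S, |∏ v : Fin s, Fhat (deg v) (2 * (M *ᵥ x) v + a v)|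
      ≤ (2 * ((E * (j + 1) : ℕ) : ℚ) ^ η) ^ s := by
    intro x hx
    have hx' := (Finset.mem_filter.1 hx).2
    have hb := hB j x hx'
    rw [Finset.abs_prod]
    have : (2 * ((E * (j + 1) : ℕ) : ℚ) ^ η) ^ s
      = ∏ v : Fin s, (2 * ((E * (j + 1) : ℕ) : ℚ) ^ η) := by simp
    rw [this]
    apply Finset.prod_le_prod
    · intros; positivity
    intro v _
    have hM : ((M *ᵥ x) v).natAbs ≤ Q * R := by
      rw [mulVec, dotProduct]
      calc _ ≤ ∑ w, (M v w * x w).natAbs := Int.natAbs_sum_le _ _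
        _ ≤ ∑ w, (M v w).natAbs * R := by
          refine Finset.sum_le_sum fun w _ => ?_
          rw [Int.natAbs_mul]
          exact Nat.mul_le_mul_left _ (hb w)
        _ = (∑ w, (M v w).natAbs) * R := by rw [Finset.sum_mul]
        _ ≤ _ := by
          apply Nat.mul_le_mul_right
          exact Finset.single_le_sum (f := fun v => ∑ w, (M v w).natAbs)
            (fun _ _ => Nat.zero_le _) (Finset.mem_univ v)
    have ha : (a v).natAbs ≤ A := Finset.single_le_sum (f := fun v => (a v).natAbs)
            (fun _ _ => Nat.zero_le _) (Finset.mem_univ v)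
    have hk : (2 * (M *ᵥ x) v + a v).natAbs ≤ 2 * (Q * R) + A := by omega
    refine (Fhat_bound (deg v) η (hηmax v) _ _ hk).trans ?_
    have hle : η + (2 * (Q * R) + A) + 1 ≤ E * (j + 1) := by
      simp only [E, R]
      have : 0 ≤ (η + A) * j := Nat.zero_le _
      nlinarith
    gcongr
  rw [hS, finsum_mem_coe_finset]
  calc _ ≤ ∑ x ∈ S, |∏ v : Fin s, Fhat (deg v) (2 * (M *ᵥ x) v + a v)| :=
        Finset.abs_sum_le_sum_abs _ _
    _ ≤ S.card • (2 * ((E * (j + 1) : ℕ) : ℚ) ^ η) ^ s := Finset.sum_le_card_nsmul _ _ _ hterm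
    _ = (S.card : ℚ) * (2 * ((E * (j + 1) : ℕ) : ℚ) ^ η) ^ s := by rw [nsmul_eq_mul]
    _ ≤ ((((2 * B + 1) * (j + 1)) ^ s : ℕ) : ℚ) * (2 * ((E * (j + 1) : ℕ) : ℚ) ^ η) ^ s := by
        gcongr
    _ = _ := by push_cast; simp only [mul_pow, pow_add, pow_mul]; ring

theorem lim_aux (L K b : ℝ) :
    Tendsto (fun n : ℕ => ((L + K * Real.log ((n : ℝ) + 1)) / √(n : ℝ) + b) ^ 2) atTop
      (nhds (b ^ 2)) := by
  have h0 : Tendsto (fun n : ℕ => √(n : ℝ)) atTop atTop :=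
    Real.tendsto_sqrt_atTop.comp tendsto_natCast_atTop_atTop
  have h1 : Tendsto (fun n : ℕ => L / √(n : ℝ)) atTop (nhds 0) := h0.const_div_atTop L
  have h2 : Tendsto (fun n : ℕ => Real.log ((n : ℝ) + 1) / √(n : ℝ)) atTop (nhds 0) := by
    have h3 : Tendsto (fun x : ℝ => Real.log x / x ^ (1 / 2 : ℝ)) atTop (nhds 0) :=
      (isLittleO_log_rpow_atTop (by norm_num)).tendsto_div_nhds_zero
    have h4 : Tendsto (fun n : ℕ => (Real.log 2 + Real.log (n : ℝ)) / √(n : ℝ)) atTop (nhds 0) := by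
      have h5 := (h0.const_div_atTop (Real.log 2)).add (h3.comp tendsto_natCast_atTop_atTop)
      simp only [add_zero] at h5
      refine h5.congr fun n => ?_
      simp only [Function.comp, ← Real.sqrt_eq_rpow]
      ring
    refine squeeze_zero' (Eventually.of_forall fun n => ?_) ?_ h4
    · have : (0:ℝ) ≤ n := by positivity
      exact div_nonneg (Real.log_nonneg (by linarith)) (Real.sqrt_nonneg _)
    · filter_upwards [eventually_ge_atTop 1] with n hn
      have hn' : (1:ℝ) ≤ n := by exact_mod_cast hn
      rw [← Real.log_mul (by norm_num) (by linarith)]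
      gcongr
      linarith
  have h6 := ((h1.add (h2.const_mul K)).add_const b).pow 2
  simp only [mul_zero, add_zero, zero_add] at h6
  refine h6.congr fun n => ?_
  congr 1
  ring

/-- For a negative definite plumbed manifold, the convolution
`d_n = ∑_{m≤n} p(n−m)·c_m` (the coefficients of `Ẑ_a(M₃;q)/(q;q)_∞`) satisfies
`limsup (log|d_n|)²/n ≤ 2π²/3`; i.e. the effective central charge of
`Ẑ_a(M₃;q)/(q;q)_∞` is at most `1`. -/
theorem stmt13 (s : ℕ) (hs : 1 ≤ s) (M : Matrix (Fin s) (Fin s) ℤ)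
    (hsymm : M.IsSymm)
    (hneg : ∀ x : Fin s → ℝ, x ≠ 0 → x ⬝ᵥ ((M.map ((↑) : ℤ → ℝ)) *ᵥ x) < 0)
    (a : Fin s → ℤ) (deg : Fin s → ℕ) (η : ℕ) (hη : 3 ≤ η)
    (hηmax : ∀ v, deg v ≤ η) (hηmem : ∃ v, deg v = η)
    (c : ℕ → ℚ)
    (hc : ∀ j : ℕ, c j =
      ∑ᶠ x ∈ {x : Fin s → ℤ | -(x ⬝ᵥ (M *ᵥ x) + x ⬝ᵥ a) = (j : ℤ)},
        ∏ v : Fin s, Fhat (deg v) (2 * (M *ᵥ x) v + a v))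
    (d : ℕ → ℚ)
    (hd : ∀ n : ℕ, d n = ∑ m ∈ Finset.range (n + 1),
      (Fintype.card (Nat.Partition (n - m)) : ℚ) * c m) :
    limsup (fun n : ℕ => (Real.log |(d n : ℝ)|) ^ 2 / n) atTop ≤ 2 * Real.pi ^ 2 / 3 := by
  obtain ⟨C, K, hC, hcb⟩ := c_bound_s13 s hs M hneg a deg η hηmax
  set b : ℝ := Real.pi * √(2 / 3) with hb
  have hb0 : 0 ≤ b := by positivity
  have hb2 : b ^ 2 = 2 * Real.pi ^ 2 / 3 := by
    rw [hb, mul_pow, Real.sq_sqrt (by norm_num)]; ring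
  have hcb' : ∀ j, |(c j : ℝ)| ≤ C * ((j : ℝ) + 1) ^ K := by
    intro j
    have := hcb j
    rw [← hc j] at this
    exact_mod_cast this
  -- upper bound
  have hup : ∀ n : ℕ, |(d n : ℝ)| ≤ C * ((n : ℝ) + 1) ^ (K + 1) * Real.exp (b * √n) := by
    intro n
    rw [hd n]
    push_cast
    refine (Finset.abs_sum_le_sum_abs _ _).trans ?_
    have : ∀ m ∈ Finset.range (n + 1),
        |(Fintype.card (Nat.Partition (n - m)) : ℝ) * (c m : ℝ)| ≤
          Real.exp (b * √n) * (C * ((n : ℝ) + 1) ^ K) := by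
      intro m hm
      have hm' : m ≤ n := by simpa [Nat.lt_succ_iff] using hm
      rw [abs_mul, abs_of_nonneg (by positivity : (0:ℝ) ≤ (Fintype.card (Nat.Partition (n - m)) : ℝ))]
      apply mul_le_mul _ _ (abs_nonneg _) (Real.exp_pos _).le
      · refine (part_bound (n - m)).trans (Real.exp_le_exp.2 ?_)
        rw [← hb]
        gcongr
        omega
      · refine (hcb' m).trans ?_
        gcongr
    refine (Finset.sum_le_card_nsmul _ _ _ this).trans (le_of_eq ?_)
    rw [Finset.card_range, nsmul_eq_mul]
    push_cast
    ring
  -- integrality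
  have hint : ∀ n : ℕ, ∃ z : ℤ, 2 ^ s * d n = z := by
    intro n
    choose z hz using fun j : ℕ => c_int s M a deg
      {x : Fin s → ℤ | -(x ⬝ᵥ (M *ᵥ x) + x ⬝ᵥ a) = (j : ℤ)}
    refine ⟨∑ m ∈ Finset.range (n + 1), (Fintype.card (Nat.Partition (n - m)) : ℤ) * z m, ?_⟩
    rw [hd n, Finset.mul_sum]
    push_cast
    refine Finset.sum_congr rfl fun m _ => ?_
    rw [← hz m, ← hc m]
    ring
  have hlow : ∀ n : ℕ, -(s * Real.log 2) ≤ Real.log |(d n : ℝ)| := by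
    intro n
    have hl2 : 0 ≤ Real.log 2 := Real.log_nonneg (by norm_num)
    by_cases h0 : d n = 0
    · simp only [h0, Rat.cast_zero, abs_zero, Real.log_zero]
      have : 0 ≤ s * Real.log 2 := by positivity
      linarith
    obtain ⟨z, hz⟩ := hint n
    have hz0 : z ≠ 0 := by
      rintro rfl
      simp [h0] at hz
    have hzR : (2:ℝ) ^ s * (d n : ℝ) = z := by exact_mod_cast hz
    have h1 : (1:ℝ) ≤ |(z:ℝ)| := by exact_mod_cast Int.one_le_abs hz0
    have hd0 : 0 < |(d n : ℝ)| := abs_pos.2 (by exact_mod_cast h0)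
    rw [← hzR, abs_mul, abs_of_pos (by positivity : (0:ℝ) < 2 ^ s)] at h1
    have h2 := Real.log_nonneg h1
    rw [Real.log_mul (by positivity) hd0.ne', Real.log_pow] at h2
    linarith
  set L : ℝ := Real.log C + s * Real.log 2 with hL
  have hCR : (1:ℝ) ≤ C := by exact_mod_cast hC
  have habs : ∀ n : ℕ, |(Real.log (|(d n : ℝ)|))| ≤ L + ((K : ℝ) + 1) * Real.log ((n:ℝ) + 1) + b * √n := by
    intro n
    have hl2 : 0 ≤ s * Real.log 2 := mul_nonneg (by positivity) (Real.log_nonneg (by norm_num))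
    have hlC : 0 ≤ Real.log C := Real.log_nonneg hCR
    have hn0 : (0:ℝ) ≤ n := by positivity
    have hln : 0 ≤ ((K : ℝ) + 1) * Real.log ((n:ℝ) + 1) :=
      mul_nonneg (by positivity) (Real.log_nonneg (by linarith))
    have hbn : 0 ≤ b * √(n:ℝ) := by positivity
    rw [abs_le]
    constructor
    · have := hlow n
      linarith
    · by_cases h0 : d n = 0
      · simp only [h0, Rat.cast_zero, abs_zero, Real.log_zero]
        linarith
      have hd0 : 0 < |(d n : ℝ)| := abs_pos.2 (by exact_mod_cast h0)
      have h1 := Real.log_le_log hd0 (hup n)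
      rw [Real.log_mul (by positivity) (Real.exp_pos _).ne', Real.log_exp,
        Real.log_mul (by positivity) (by positivity), Real.log_pow] at h1
      push_cast at h1
      linarith
  have hlim := lim_aux L ((K : ℝ) + 1) b
  rw [← hb2, ← hlim.limsup_eq]
  apply limsup_le_limsup
  · filter_upwards [eventually_ge_atTop 1] with n hn
    have hn' : (1:ℝ) ≤ n := by exact_mod_cast hn
    have hs : 0 < √(n:ℝ) := Real.sqrt_pos.2 (by linarith)
    have h1 : (Real.log |(d n : ℝ)|) ^ 2 / n = (|(Real.log (|(d n : ℝ)|))| / √(n:ℝ)) ^ 2 := by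
      rw [div_pow, sq_abs, Real.sq_sqrt (by linarith)]
    rw [h1]
    apply pow_le_pow_left₀ (by positivity)
    rw [div_le_iff₀ hs, add_mul, div_mul_cancel₀ _ hs.ne']
    exact habs n
  · exact IsBoundedUnder.isCoboundedUnder_le
      (isBoundedUnder_of_eventually_ge (a := 0) (Eventually.of_forall fun n : ℕ =>
        div_nonneg (sq_nonneg (Real.log |(d n : ℝ)|)) (Nat.cast_nonneg n)))
  · exact hlim.isBoundedUnder_le
end
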